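/- Fix integers K ≥ 1, n_t ≥ 1, n_r ≥ 1, a real ρ > 0, power budgets P̄_k > 0, strictly positive weights p_π > 0 indexed by the permutations π of {1,…,K} with ∑_π p_π = 1, and fixed complex n_r×n_t channel matrices H_1,…,H_K each of rank n_t (full column rank). For k ∈ {1,…,K} define the strategy set A_k^SIC = {(Q_k^{(π)})_π : each Q_k^{(π)} is an n_t×n_t Hermitian positive semidefinite complex matrix and ∑_π p_π Tr(Q_k^{(π)}) ≤ n_t P̄_k}, and the utility u_k^SIC(Q_1,…,Q_K) = ∑_π p_π [logdet(I + ρ H_k Q_k^{(π)} H_k^H + ρ ∑_{ℓ: π(ℓ)>π(k)} H_ℓ Q_ℓ^{(π)} H_ℓ^H) − logdet(I + ρ ∑_{ℓ: π(ℓ)>π(k)} H_ℓ Q_ℓ^{(π)} H_ℓ^H)]. Then this K-player game has exactly one Nash equilibrium. -/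

import Mathlib

open Matrix
open scoped ComplexOrder

/-- `logdet M = log det M` for a (positive definite Hermitian) complex matrix, whose
determinant is a positive real number. -/
noncomputable def logdet {m : ℕ} (M : Matrix (Fin m) (Fin m) ℂ) : ℝ :=
  Real.log M.det.re

/-- The SIC strategy set of a player with power budget `Pb`: tuples, indexed by the
decoding orders `π`, of Hermitian positive semidefinite `nt×nt` matrices whose
`p`-averaged trace is at most `nt * Pb`. -/
def SICset (K nt : ℕ) (p : Equiv.Perm (Fin K) → ℝ) (Pb : ℝ) :
    Set (Equiv.Perm (Fin K) → Matrix (Fin nt) (Fin nt) ℂ) :=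
  {Q | (∀ π, (Q π).PosSemidef) ∧ ∑ π, p π * (Q π).trace.re ≤ nt * Pb}

/-- The static SIC utility of player `k`: the `p`-average over decoding orders of
`logdet(I + ρ H_k Q_k^{(π)} H_kᴴ + ρ ∑_{π(ℓ)>π(k)} H_ℓ Q_ℓ^{(π)} H_ℓᴴ)
− logdet(I + ρ ∑_{π(ℓ)>π(k)} H_ℓ Q_ℓ^{(π)} H_ℓᴴ)`. -/
noncomputable def uSICstatic {K nt nr : ℕ}
    (ρ : ℝ) (p : Equiv.Perm (Fin K) → ℝ)
    (H : Fin K → Matrix (Fin nr) (Fin nt) ℂ) (k : Fin K)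
    (Q : Fin K → Equiv.Perm (Fin K) → Matrix (Fin nt) (Fin nt) ℂ) : ℝ :=
  ∑ π : Equiv.Perm (Fin K), p π *
    (logdet (1 + (ρ : ℂ) • (H k * Q k π * (H k)ᴴ)
        + (ρ : ℂ) • ∑ ℓ ∈ Finset.univ.filter (fun ℓ => π k < π ℓ),
            H ℓ * Q ℓ π * (H ℓ)ᴴ)
      - logdet (1 + (ρ : ℂ) • ∑ ℓ ∈ Finset.univ.filter (fun ℓ => π k < π ℓ),
            H ℓ * Q ℓ π * (H ℓ)ᴴ))

open Filter Topology

/-- Minty's lemma: a monotone operator on a nonempty compact convex set solves the weak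
variational inequality. -/
theorem exists_weak_variational_solution {E : Type*} [AddCommGroup E] [Module ℝ E]
    [TopologicalSpace E] [IsTopologicalAddGroup E] [ContinuousSMul ℝ E] {C : Set E}
    (hconv : Convex ℝ C) (hcomp : IsCompact C) (hne : C.Nonempty) (φ : E → E →ₗ[ℝ] ℝ)
    (hφ : ∀ x, Continuous (φ x))
    (hmono : ∀ x ∈ C, ∀ y ∈ C, 0 ≤ φ y (y - x) - φ x (y - x)) :
    ∃ x ∈ C, ∀ y ∈ C, 0 ≤ φ y (y - x) := by
  have hclosed (y : C) : IsClosed {x : E | 0 ≤ φ y (y - x)} :=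
    isClosed_le continuous_const ((hφ y).comp (continuous_const.sub continuous_id))
  obtain ⟨x, hxC, hx⟩ := hcomp.inter_iInter_nonempty
    (fun y : C => {x : E | 0 ≤ φ y (y - x)}) hclosed fun s => by
    rcases s.eq_empty_or_nonempty with rfl | hs
    · simpa using hne
    have : Nonempty s := hs.to_subtype
    classical
    let f : E → (s → ℝ) → ℝ := fun x w => ∑ i, w i * φ i.1.1 (x - i.1.1)
    have hf1 (w : s → ℝ) : Continuous fun x => f x w :=
      continuous_finsetSum _ fun i _ => continuous_const.mul
        ((hφ i.1.1).comp (continuous_id.sub continuous_const))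
    have hf2 (x : E) : Continuous fun w => f x w := by
      simp only [f]; fun_prop
    have hf1' (w : s → ℝ) : ConvexOn ℝ C fun x => f x w := by
      refine ⟨hconv, fun x _ y _ a b _ _ hab => le_of_eq ?_⟩
      simp only [f, smul_eq_mul, Finset.mul_sum, ← Finset.sum_add_distrib]
      refine Finset.sum_congr rfl fun i _ => ?_
      simp only [map_sub, map_add, map_smul, smul_eq_mul]
      linear_combination (w i * φ i.1.1 i.1.1) * hab
    have hf2' (x : E) : ConcaveOn ℝ (stdSimplex ℝ s) fun w => f x w := by
      refine ⟨convex_stdSimplex ℝ s, fun x _ y _ a b _ _ _ => le_of_eq ?_⟩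
      simp only [f, smul_eq_mul, Finset.mul_sum, ← Finset.sum_add_distrib]
      refine Finset.sum_congr rfl fun i _ => ?_
      simp only [Pi.add_apply, Pi.smul_apply, smul_eq_mul]
      ring
    obtain ⟨a, ha, b, hb, hab⟩ := Sion.exists_isSaddlePointOn (f := f) hne hconv hcomp
      (fun w _ => (hf1 w).lowerSemicontinuous.lowerSemicontinuousOn _)
      (fun w _ => (hf1' w).quasiconvexOn) (convex_stdSimplex ℝ s)
      ⟨_, single_mem_stdSimplex ℝ (Classical.arbitrary s)⟩ (isCompact_stdSimplex ℝ s)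
      (fun x _ => (hf2 x).upperSemicontinuous.upperSemicontinuousOn _)
      (fun x _ => (hf2' x).quasiconcaveOn)
    refine ⟨a, ha, Set.mem_iInter₂.2 fun i hi => ?_⟩
    have hz : ∑ j, b j • j.1.1 ∈ C :=
      hconv.sum_mem (fun j _ => hb.1 j) hb.2 fun j _ => j.1.2
    have h := hab _ hz _ (single_mem_stdSimplex ℝ ⟨i, hi⟩)
    have h1 : f a (Pi.single ⟨i, hi⟩ 1) = φ i.1 (a - i.1) := by
      simp [f, Pi.single_apply]
    have h2 : f (∑ j, b j • j.1.1) b ≤ 0 := by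
      have e : f (∑ j, b j • j.1.1) b
          = ∑ l, ∑ j, b l * b j * φ l.1.1 (j.1.1 - l.1.1) := by
        refine Finset.sum_congr rfl fun l _ => ?_
        have : ∑ j, b j • j.1.1 - l.1.1 = ∑ j, b j • (j.1.1 - l.1.1) := by
          simp only [smul_sub, Finset.sum_sub_distrib, ← Finset.sum_smul, hb.2, one_smul]
        rw [this, map_sum, Finset.mul_sum]
        exact Finset.sum_congr rfl fun j _ => by rw [map_smul, smul_eq_mul, mul_assoc]
      have e' := e
      rw [Finset.sum_comm] at e'
      have : f (∑ j, b j • j.1.1) b + f (∑ j, b j • j.1.1) b ≤ 0 := by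
        nth_rw 1 [e, e', ← Finset.sum_add_distrib]
        refine Finset.sum_nonpos fun l _ => ?_
        rw [← Finset.sum_add_distrib]
        refine Finset.sum_nonpos fun j _ => ?_
        have hm := hmono l.1.1 l.1.2 j.1.1 j.1.2
        have hw : 0 ≤ b l * b j := mul_nonneg (hb.1 l) (hb.1 j)
        rw [← neg_sub j.1.1 l.1.1, map_neg]
        nlinarith
      linarith
    rw [h1] at h
    simp only [Set.mem_ofPred_eq]
    rw [← neg_sub a, map_neg]
    linarith
  exact ⟨x, hxC, fun y hy => Set.mem_iInter.1 hx ⟨y, hy⟩⟩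

/-- A monotone operator on a nonempty compact convex set that is continuous along segments
solves the variational inequality. -/
theorem exists_variational_solution {E : Type*} [AddCommGroup E] [Module ℝ E]
    [TopologicalSpace E] [IsTopologicalAddGroup E] [ContinuousSMul ℝ E] {C : Set E}
    (hconv : Convex ℝ C) (hcomp : IsCompact C) (hne : C.Nonempty) (φ : E → E →ₗ[ℝ] ℝ)
    (hφ : ∀ x, Continuous (φ x))
    (hmono : ∀ x ∈ C, ∀ y ∈ C, 0 ≤ φ y (y - x) - φ x (y - x))
    (hhemi : ∀ x ∈ C, ∀ y ∈ C,
      Tendsto (fun t : ℝ => φ (x + t • (y - x)) (y - x)) (𝓝[>] 0) (𝓝 (φ x (y - x)))) :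
    ∃ x ∈ C, ∀ y ∈ C, 0 ≤ φ x (y - x) := by
  obtain ⟨x, hx, h⟩ := exists_weak_variational_solution hconv hcomp hne φ hφ hmono
  refine ⟨x, hx, fun y hy => ge_of_tendsto (hhemi x hx y hy) ?_⟩
  filter_upwards [Ioc_mem_nhdsGT (zero_lt_one' ℝ)] with t ht
  have := h _ (hconv.add_smul_sub_mem hx hy ⟨ht.1.le, ht.2⟩)
  rw [add_sub_cancel_left, map_smul, smul_eq_mul] at this
  exact nonneg_of_mul_nonneg_right this ht.1

section TraceInequality

variable {n : Type*} [Fintype n] [DecidableEq n]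

open scoped MatrixOrder in
theorem Matrix.PosSemidef.exists_eq_conjTranspose_mul_self {P : Matrix n n ℂ}
    (hP : P.PosSemidef) : ∃ B : Matrix n n ℂ, P = Bᴴ * B :=
  CStarAlgebra.nonneg_iff_eq_star_mul_self.mp hP.nonneg

theorem Matrix.PosSemidef.re_trace_mul_nonneg {P Q : Matrix n n ℂ} (hP : P.PosSemidef)
    (hQ : Q.PosSemidef) : 0 ≤ (P * Q).trace.re := by
  obtain ⟨B, rfl⟩ := hQ.exists_eq_conjTranspose_mul_self
  rw [← Matrix.mul_assoc, Matrix.trace_mul_comm, ← Matrix.mul_assoc]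
  exact (Complex.le_def.1 (hP.mul_mul_conjTranspose_same B).trace_nonneg).1

theorem Matrix.PosDef.logdet_le_add_trace {m : ℕ} {M N : Matrix (Fin m) (Fin m) ℂ}
    (hM : M.PosDef) (hN : N.PosDef) :
    logdet N ≤ logdet M + (M⁻¹ * (N - M)).trace.re := by
  have key {P : Matrix (Fin m) (Fin m) ℂ} (hP : P.PosDef) :
      Real.log P.det.re ≤ P.trace.re - m := by
    rw [hP.1.det_eq_prod_eigenvalues, hP.1.trace_eq_sum_eigenvalues]
    simp only [Complex.coe_algebraMap, ← Complex.ofReal_prod, ← Complex.ofReal_sum,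
      Complex.ofReal_re]
    rw [Real.log_prod fun i _ => (hP.eigenvalues_pos i).ne']
    calc _ ≤ ∑ i, (hP.1.eigenvalues i - 1) :=
          Finset.sum_le_sum fun i _ => Real.log_le_sub_one_of_pos (hP.eigenvalues_pos i)
      _ = _ := by simp
  obtain ⟨B, hB⟩ := hM.inv.posSemidef.exists_eq_conjTranspose_mul_self
  have hBu : IsUnit B := by
    have := hM.inv.isUnit
    rw [hB] at this
    exact (Matrix.isUnit_iff_isUnit_det _).2
      (isUnit_of_mul_isUnit_right (by
        simpa only [Matrix.det_mul] using (Matrix.isUnit_iff_isUnit_det _).1 this))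
  have hP : (B * N * Bᴴ).PosDef :=
    hN.mul_mul_conjTranspose_same (Matrix.vecMul_injective_iff_isUnit.2 hBu)
  have hMdet : IsUnit M.det := (Matrix.isUnit_iff_isUnit_det _).1 hM.isUnit
  have h1 : (B * N * Bᴴ).trace = (M⁻¹ * N).trace := by
    rw [hB, Matrix.trace_mul_comm, Matrix.mul_assoc]
  have h2 : (B * N * Bᴴ).det * M.det = N.det := by
    have h3 : M⁻¹.det * M.det = 1 := by
      rw [← Matrix.det_mul, Matrix.nonsing_inv_mul _ hMdet, Matrix.det_one]
    rw [hB, Matrix.det_mul] at h3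
    rw [Matrix.det_mul, Matrix.det_mul]
    linear_combination N.det * h3
  have hre {P : Matrix (Fin m) (Fin m) ℂ} (hP : P.PosDef) : 0 < P.det.re ∧ P.det.im = 0 := by
    have := Complex.lt_def.1 hP.det_pos
    exact ⟨this.1, this.2.symm⟩
  have h4 := key hP
  have h5 : N.det.re = (B * N * Bᴴ).det.re * M.det.re := by
    rw [← h2, Complex.mul_re, (hre hM).2, mul_zero, sub_zero]
  rw [logdet, h5, Real.log_mul (hre hP).1.ne' (hre hM).1.ne', Matrix.mul_sub,
    Matrix.nonsing_inv_mul _ hMdet, Matrix.trace_sub, ← h1]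
  simp only [Matrix.trace_one, Complex.sub_re, Fintype.card_fin, Complex.natCast_re]
  simp only [logdet]
  linarith

/-- The inverse is antitone on positive definite matrices. -/
theorem Matrix.PosDef.posSemidef_inv_sub_inv_add {X A : Matrix n n ℂ} (hX : X.PosDef)
    (hA : A.PosSemidef) : (X⁻¹ - (X + A)⁻¹).PosSemidef := by
  have hZ := hX.add_posSemidef hA
  have uX := (Matrix.isUnit_iff_isUnit_det _).1 hX.isUnit
  have uZ := (Matrix.isUnit_iff_isUnit_det _).1 hZ.isUnit
  set Z := (X + A)⁻¹ with hZdef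
  have e1 : X⁻¹ - Z = Z * A * X⁻¹ := by
    have : Z * (X + A) * X⁻¹ = X⁻¹ := by
      rw [Matrix.nonsing_inv_mul _ uZ, Matrix.one_mul]
    rw [Matrix.mul_add, Matrix.add_mul, Matrix.mul_nonsing_inv_cancel_right _ _ uX] at this
    rw [sub_eq_iff_eq_add, add_comm, this]
  have e2 : X⁻¹ - Z = X⁻¹ * A * Z := by
    have : X⁻¹ * ((X + A) * Z) = X⁻¹ := by
      rw [Matrix.mul_nonsing_inv _ uZ, Matrix.mul_one]
    rw [Matrix.add_mul, Matrix.mul_add, Matrix.nonsing_inv_mul_cancel_left _ _ uX] at this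
    rw [sub_eq_iff_eq_add, add_comm, Matrix.mul_assoc, this]
  have hZH : Zᴴ = Z := hZ.inv.1
  have e3 : X⁻¹ - Z = Z * A * Zᴴ + (Z * A) * X⁻¹ * (Z * A)ᴴ := by
    rw [Matrix.conjTranspose_mul, hZH, hA.1.eq]
    calc X⁻¹ - Z = Z * A * (Z + (X⁻¹ - Z)) := by rw [add_sub_cancel, e1]
      _ = _ := by rw [e2]; simp only [Matrix.mul_add, Matrix.mul_assoc]
  rw [e3]
  exact (hA.mul_mul_conjTranspose_same _).add
    (hX.inv.posSemidef.mul_mul_conjTranspose_same _)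

theorem Matrix.PosSemidef.re_trace_form_nonneg {P Q D : Matrix n n ℂ} (hP : P.PosSemidef)
    (hQ : Q.PosSemidef) (hD : D.IsHermitian) : 0 ≤ (D * P * D * Q).trace.re := by
  have := hP.mul_mul_conjTranspose_same D
  rw [hD.eq] at this
  exact this.re_trace_mul_nonneg hQ

theorem Matrix.PosDef.eq_zero_of_re_trace_form {P Q D : Matrix n n ℂ} (hP : P.PosDef)
    (hQ : Q.PosDef) (hD : D.IsHermitian) (h : (D * P * D * Q).trace.re = 0) : D = 0 := by
  obtain ⟨B, hB⟩ := hQ.posSemidef.exists_eq_conjTranspose_mul_self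
  obtain ⟨C, hC⟩ := hP.posSemidef.exists_eq_conjTranspose_mul_self
  have e : (D * P * D * Q).trace = ((C * D * Bᴴ)ᴴ * (C * D * Bᴴ)).trace := by
    simp only [Matrix.conjTranspose_mul, Matrix.conjTranspose_conjTranspose, hD.eq]
    rw [Matrix.mul_assoc B, Matrix.trace_mul_comm B, hB, hC]
    simp only [Matrix.mul_assoc]
  have hps := Matrix.posSemidef_conjTranspose_mul_self (C * D * Bᴴ)
  have h0 : ((C * D * Bᴴ)ᴴ * (C * D * Bᴴ)).trace = 0 := by
    refine Complex.ext (by rw [← e, h, Complex.zero_re]) ?_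
    exact (Complex.le_def.1 hps.trace_nonneg).2.symm
  rw [Matrix.trace_conjTranspose_mul_self_eq_zero_iff] at h0
  have h1 : P * D * Q = 0 := by
    rw [hB, hC]
    calc Cᴴ * C * D * (Bᴴ * B) = Cᴴ * (C * D * Bᴴ) * B := by simp only [Matrix.mul_assoc]
      _ = 0 := by rw [h0]; simp
  rwa [hQ.isUnit.mul_left_eq_zero, hP.isUnit.mul_right_eq_zero] at h1

/-- The quadratic form `D ↦ Re Tr(D Y⁻¹ D X⁻¹)` governing the monotonicity of the inverse. -/
noncomputable def invForm (X Y D : Matrix n n ℂ) : ℝ := (D * Y⁻¹ * D * X⁻¹).trace.re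

theorem invForm_add_le {X Y A B D : Matrix n n ℂ} (hX : X.PosDef) (hY : Y.PosDef)
    (hA : A.PosSemidef) (hB : B.PosSemidef) (hD : D.IsHermitian) :
    invForm (X + A) (Y + B) D ≤ invForm X Y D := by
  have h1 := (hY.add_posSemidef hB).inv.posSemidef.re_trace_form_nonneg
    (hX.posSemidef_inv_sub_inv_add hA) hD
  have h2 := (hY.posSemidef_inv_sub_inv_add hB).re_trace_form_nonneg hX.inv.posSemidef hD
  simp only [Matrix.mul_sub, Matrix.sub_mul, Matrix.trace_sub, Complex.sub_re] at h1 h2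
  simp only [invForm]
  linarith

theorem invForm_step {X Y A B : Matrix n n ℂ} (hX : X.PosDef) (hY : Y.PosDef)
    (hA : A.PosSemidef) (hB : B.PosSemidef) :
    invForm (X + A) (Y + B) (X + A - (Y + B)) - invForm X Y (X - Y)
        + invForm (X + A) (Y + B) (A - B)
      ≤ -2 * (((X + A)⁻¹ - (Y + B)⁻¹) * (A - B)).trace.re := by
  have hX' := hX.add_posSemidef hA
  have hY' := hY.add_posSemidef hB
  have hD : (X - Y).IsHermitian := hX.1.sub hY.1
  have hE : (A - B).IsHermitian := hA.1.sub hB.1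
  have h := invForm_add_le hX hY hA hB hD
  have uX := (Matrix.isUnit_iff_isUnit_det _).1 hX'.isUnit
  have uY := (Matrix.isUnit_iff_isUnit_det _).1 hY'.isUnit
  have hs : X + A - (Y + B) = (X - Y) + (A - B) := by abel
  have hinv : (X + A)⁻¹ - (Y + B)⁻¹ = -((Y + B)⁻¹ * ((X - Y) + (A - B)) * (X + A)⁻¹) := by
    rw [← hs, Matrix.mul_sub, Matrix.sub_mul, Matrix.mul_assoc, Matrix.mul_nonsing_inv _ uX,
      Matrix.nonsing_inv_mul _ uY, Matrix.mul_one, Matrix.one_mul, neg_sub]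
  have hZ : ((X + A)⁻¹)ᴴ = (X + A)⁻¹ := hX'.inv.1
  have hW : ((Y + B)⁻¹)ᴴ = (Y + B)⁻¹ := hY'.inv.1
  rw [hinv, hs]
  simp only [invForm] at h ⊢
  generalize (X + A)⁻¹ = Z at *
  generalize (Y + B)⁻¹ = W at *
  generalize X - Y = D at *
  generalize A - B = F at *
  have hsym : (D * W * F * Z).trace.re = (F * W * D * Z).trace.re := by
    have : ((D * W * F * Z)ᴴ).trace = (F * W * D * Z).trace := by
      simp only [Matrix.conjTranspose_mul, hZ, hW, hD.eq, hE.eq]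
      rw [Matrix.trace_mul_comm]
      simp only [Matrix.mul_assoc]
    rw [← this, Matrix.trace_conjTranspose, Complex.star_def, Complex.conj_re]
  have hcyc : (W * (D + F) * Z * F).trace = (F * W * (D + F) * Z).trace := by
    rw [Matrix.trace_mul_comm]
    simp only [Matrix.mul_assoc]
  rw [Matrix.neg_mul, Matrix.trace_neg, hcyc]
  simp only [Matrix.mul_add, Matrix.add_mul, Matrix.trace_add, Complex.add_re, Complex.neg_re]
    at h ⊢
  linarith

theorem invForm_nonneg {X Y D : Matrix n n ℂ} (hX : X.PosDef) (hY : Y.PosDef)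
    (hD : D.IsHermitian) : 0 ≤ invForm X Y D :=
  hY.inv.posSemidef.re_trace_form_nonneg hX.inv.posSemidef hD

/-- The trace inequality of Belmega, Lasaulce and Debbah for chains of positive definite
matrices, in quantitative form. -/
theorem sum_invForm_le_sum_trace {K : ℕ} {X Y : ℕ → Matrix n n ℂ}
    (hX : ∀ i, (X i).PosDef) (hY : ∀ i, (Y i).PosDef)
    (hA : ∀ i, (X i - X (i + 1)).PosSemidef) (hB : ∀ i, (Y i - Y (i + 1)).PosSemidef)
    (hK : X K = Y K) :
    ∑ i ∈ Finset.range K, invForm (X i) (Y i) (X i - X (i + 1) - (Y i - Y (i + 1)))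
      ≤ -2 * ∑ i ∈ Finset.range K,
        (((X i)⁻¹ - (Y i)⁻¹) * (X i - X (i + 1) - (Y i - Y (i + 1)))).trace.re := by
  have step (i : ℕ) := invForm_step (hX (i + 1)) (hY (i + 1)) (hA i) (hB i)
  simp only [add_sub_cancel] at step
  have h := Finset.sum_le_sum fun i (_ : i ∈ Finset.range K) => step i
  rw [Finset.sum_add_distrib, Finset.sum_range_sub' fun i => invForm (X i) (Y i) (X i - Y i),
    hK, sub_self, ← Finset.mul_sum] at h
  have h0 := invForm_nonneg (hX 0) (hY 0) ((hX 0).1.sub (hY 0).1)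
  have hK0 : invForm (Y K) (Y K) 0 = 0 := by simp [invForm]
  linarith

end TraceInequality

section StrategySets

variable {K nt : ℕ} {p : Equiv.Perm (Fin K) → ℝ}

theorem Matrix.PosSemidef.norm_apply_le_trace {m : ℕ} {Q : Matrix (Fin m) (Fin m) ℂ}
    (hQ : Q.PosSemidef) (i j : Fin m) : ‖Q i j‖ ≤ Q.trace.re := by
  obtain ⟨B, rfl⟩ := hQ.exists_eq_conjTranspose_mul_self
  have hd (l : Fin m) : ((Bᴴ * B) l l).re = ∑ r, ‖B r l‖ ^ 2 := by
    simp only [Matrix.mul_apply, Matrix.conjTranspose_apply, Complex.re_sum]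
    refine Finset.sum_congr rfl fun r _ => ?_
    rw [Complex.star_def, ← Complex.normSq_eq_conj_mul_self, Complex.ofReal_re,
      Complex.normSq_eq_norm_sq]
  have hle (l : Fin m) : ((Bᴴ * B) l l).re ≤ (Bᴴ * B).trace.re := by
    rw [Matrix.trace, Complex.re_sum]
    exact Finset.single_le_sum (f := fun l => ((Bᴴ * B) l l).re)
      (fun l _ => by rw [hd]; positivity) (Finset.mem_univ l)
  have hij : ‖(Bᴴ * B) i j‖ ≤ ∑ r, (‖B r i‖ ^ 2 + ‖B r j‖ ^ 2) / 2 := by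
    rw [Matrix.mul_apply]
    refine (norm_sum_le _ _).trans (Finset.sum_le_sum fun r _ => ?_)
    rw [norm_mul, Matrix.conjTranspose_apply, norm_star]
    nlinarith [sq_nonneg (‖B r i‖ - ‖B r j‖)]
  rw [← Finset.sum_div, Finset.sum_add_distrib, ← hd, ← hd] at hij
  linarith [hle i, hle j]

theorem isClosed_setOf_posSemidef {m : ℕ} :
    IsClosed {M : Matrix (Fin m) (Fin m) ℂ | M.PosSemidef} := by
  simp only [Matrix.posSemidef_iff_dotProduct_mulVec, Set.ofPred_and, Set.ofPred_forall]
  refine IsClosed.inter (isClosed_eq (by fun_prop) continuous_id) (isClosed_iInter fun x => ?_)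
  exact isClosed_le continuous_const (by fun_prop)

theorem convex_SICset (Pb : ℝ) : Convex ℝ (SICset K nt p Pb) := by
  intro Q hQ R hR a b ha hb hab
  refine ⟨fun π => ((hQ.1 π).smul ha).add ((hR.1 π).smul hb), ?_⟩
  have e : ∑ π, p π * ((a • Q + b • R) π).trace.re
      = a * ∑ π, p π * (Q π).trace.re + b * ∑ π, p π * (R π).trace.re := by
    simp only [Finset.mul_sum, ← Finset.sum_add_distrib]
    refine Finset.sum_congr rfl fun π _ => ?_
    simp only [Pi.add_apply, Pi.smul_apply, Matrix.trace_add, Matrix.trace_smul, Complex.add_re,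
      Complex.smul_re, smul_eq_mul]
    ring
  rw [e]
  calc _ ≤ a * (nt * Pb) + b * (nt * Pb) :=
        add_le_add (mul_le_mul_of_nonneg_left hQ.2 ha) (mul_le_mul_of_nonneg_left hR.2 hb)
    _ = nt * Pb := by rw [← add_mul, hab, one_mul]

theorem isCompact_SICset (hp : ∀ π, 0 < p π) (Pb : ℝ) : IsCompact (SICset K nt p Pb) := by
  have hclosed : IsClosed (SICset K nt p Pb) := by
    refine IsClosed.inter
      (s₁ := {Q : Equiv.Perm (Fin K) → Matrix (Fin nt) (Fin nt) ℂ | ∀ π, (Q π).PosSemidef}) ?_ ?_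
    · simp only [Set.ofPred_forall]
      exact isClosed_iInter fun π => IsClosed.preimage
        (f := fun Q : Equiv.Perm (Fin K) → Matrix (Fin nt) (Fin nt) ℂ => Q π)
        (continuous_apply π) isClosed_setOf_posSemidef
    · have h : Continuous fun Q : Equiv.Perm (Fin K) → Matrix (Fin nt) (Fin nt) ℂ =>
          ∑ π, p π * (Q π).trace.re := by fun_prop
      exact isClosed_le h continuous_const
  have hbox : IsCompact (Set.univ.pi fun π : Equiv.Perm (Fin K) => Set.univ.pi fun _ : Fin nt =>
      Set.univ.pi fun _ : Fin nt => Metric.closedBall (0 : ℂ) (nt * Pb / p π)) :=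
    isCompact_univ_pi fun _ => isCompact_univ_pi fun _ => isCompact_univ_pi fun _ =>
      isCompact_closedBall _ _
  refine IsCompact.of_isClosed_subset hbox hclosed fun Q hQ π _ i _ j _ => ?_
  rw [mem_closedBall_zero_iff, le_div_iff₀ (hp π)]
  have htr (π) : 0 ≤ p π * (Q π).trace.re :=
    mul_nonneg (hp π).le (Complex.le_def.1 (hQ.1 π).trace_nonneg).1
  calc ‖Q π i j‖ * p π ≤ (Q π).trace.re * p π :=
        mul_le_mul_of_nonneg_right ((hQ.1 π).norm_apply_le_trace i j) (hp π).le
    _ = p π * (Q π).trace.re := mul_comm _ _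
    _ ≤ ∑ π, p π * (Q π).trace.re :=
        Finset.single_le_sum (f := fun π => p π * (Q π).trace.re) (fun π _ => htr π)
          (Finset.mem_univ π)
    _ ≤ nt * Pb := hQ.2

end StrategySets

section Game

variable {K nt nr : ℕ}

/-- The normalized covariance of the signals decoded at position `i` or later in the order `π`,
noise included. -/
noncomputable def sicCovariance (ρ : ℝ) (H : Fin K → Matrix (Fin nr) (Fin nt) ℂ)
    (π : Equiv.Perm (Fin K)) (Q : Fin K → Equiv.Perm (Fin K) → Matrix (Fin nt) (Fin nt) ℂ)
    (i : ℕ) : Matrix (Fin nr) (Fin nr) ℂ :=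
  1 + (ρ : ℂ) • ∑ ℓ ∈ Finset.univ.filter (fun ℓ => i ≤ (π ℓ : ℕ)), H ℓ * Q ℓ π * (H ℓ)ᴴ

variable {ρ : ℝ} {p : Equiv.Perm (Fin K) → ℝ} {H : Fin K → Matrix (Fin nr) (Fin nt) ℂ}
  {Q R : Fin K → Equiv.Perm (Fin K) → Matrix (Fin nt) (Fin nt) ℂ} {π : Equiv.Perm (Fin K)}

theorem posSemidef_smul_sum (hρ : 0 < ρ) (hQ : ∀ k π, (Q k π).PosSemidef) (s : Finset (Fin K)) :
    ((ρ : ℂ) • ∑ ℓ ∈ s, H ℓ * Q ℓ π * (H ℓ)ᴴ).PosSemidef :=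
  (Matrix.posSemidef_sum s fun ℓ _ => (hQ ℓ π).mul_mul_conjTranspose_same (H ℓ)).smul
    (Complex.zero_le_real.2 hρ.le)

theorem posDef_sicCovariance (hρ : 0 < ρ) (hQ : ∀ k π, (Q k π).PosSemidef) (i : ℕ) :
    (sicCovariance ρ H π Q i).PosDef :=
  Matrix.PosDef.one.add_posSemidef (posSemidef_smul_sum hρ hQ _)

theorem sicCovariance_sub_succ (k : Fin K) :
    sicCovariance ρ H π Q (π k) - sicCovariance ρ H π Q (π k + 1)
      = (ρ : ℂ) • (H k * Q k π * (H k)ᴴ) := by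
  have : Finset.univ.filter (fun ℓ => (π k : ℕ) ≤ π ℓ)
      = insert k (Finset.univ.filter fun ℓ => (π k : ℕ) + 1 ≤ π ℓ) := by
    ext ℓ
    have : ℓ = k ↔ (π ℓ : ℕ) = π k := by rw [Fin.val_inj, π.injective.eq_iff]
    simp only [Finset.mem_filter, Finset.mem_univ, true_and, Finset.mem_insert, this]
    omega
  rw [sicCovariance, sicCovariance, this, Finset.sum_insert (by simp), smul_add]
  abel

theorem posSemidef_sicCovariance_sub_succ (hρ : 0 < ρ) (hQ : ∀ k π, (Q k π).PosSemidef)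
    (i : ℕ) : (sicCovariance ρ H π Q i - sicCovariance ρ H π Q (i + 1)).PosSemidef := by
  by_cases hi : i < K
  · have h := sicCovariance_sub_succ (ρ := ρ) (H := H) (Q := Q) (π := π) (π.symm ⟨i, hi⟩)
    rw [Equiv.apply_symm_apply] at h
    rw [h]
    exact ((hQ _ π).mul_mul_conjTranspose_same _).smul (Complex.zero_le_real.2 hρ.le)
  · have h (j : ℕ) (hj : K ≤ j) : sicCovariance ρ H π Q j = 1 := by
      rw [sicCovariance, Finset.filter_false_of_mem fun ℓ _ => by omega]
      simp
    rw [h i (by omega), h (i + 1) (by omega), sub_self]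
    exact .zero

theorem sicCovariance_update_succ (k : Fin K)
    (S : Equiv.Perm (Fin K) → Matrix (Fin nt) (Fin nt) ℂ) :
    sicCovariance ρ H π (Function.update Q k S) (π k + 1) = sicCovariance ρ H π Q (π k + 1) := by
  rw [sicCovariance, sicCovariance]
  congr 2
  refine Finset.sum_congr rfl fun ℓ hℓ => ?_
  have : ℓ ≠ k := by
    rintro rfl
    simp at hℓ
  rw [Function.update_of_ne this]

theorem sicCovariance_update (k : Fin K)
    (S : Equiv.Perm (Fin K) → Matrix (Fin nt) (Fin nt) ℂ) :
    sicCovariance ρ H π (Function.update Q k S) (π k) - sicCovariance ρ H π Q (π k)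
      = (ρ : ℂ) • (H k * (S π - Q k π) * (H k)ᴴ) := by
  have h1 := sicCovariance_sub_succ (ρ := ρ) (H := H) (Q := Q) (π := π) k
  have h2 := sicCovariance_sub_succ (ρ := ρ) (H := H) (Q := Function.update Q k S) (π := π) k
  rw [sicCovariance_update_succ, Function.update_self] at h2
  rw [Matrix.mul_sub, Matrix.sub_mul, smul_sub, ← h1, ← h2]
  abel

theorem uSICstatic_eq (k : Fin K) :
    uSICstatic ρ p H k Q = ∑ π, p π * (logdet (sicCovariance ρ H π Q (π k))
      - logdet (sicCovariance ρ H π Q (π k + 1))) := by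
  refine Finset.sum_congr rfl fun π _ => ?_
  have h := sicCovariance_sub_succ (ρ := ρ) (H := H) (Q := Q) (π := π) k
  rw [sub_eq_iff_eq_add] at h
  have e : sicCovariance ρ H π Q (π k + 1) = 1 + (ρ : ℂ) • ∑ ℓ ∈ Finset.univ.filter
      (fun ℓ => π k < π ℓ), H ℓ * Q ℓ π * (H ℓ)ᴴ := rfl
  rw [h, e, ← add_assoc, add_comm _ (1 : Matrix (Fin nr) (Fin nr) ℂ)]

theorem uSICstatic_update_sub (k : Fin K)
    (S : Equiv.Perm (Fin K) → Matrix (Fin nt) (Fin nt) ℂ) :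
    uSICstatic ρ p H k (Function.update Q k S) - uSICstatic ρ p H k Q
      = ∑ π, p π * (logdet (sicCovariance ρ H π (Function.update Q k S) (π k))
        - logdet (sicCovariance ρ H π Q (π k))) := by
  rw [uSICstatic_eq, uSICstatic_eq, ← Finset.sum_sub_distrib]
  refine Finset.sum_congr rfl fun π _ => ?_
  rw [sicCovariance_update_succ]
  ring

/-- The directional derivative of the utility of player `k` at `Q` along the change `V` of its own
strategy. -/
noncomputable def sicGradient (ρ : ℝ) (p : Equiv.Perm (Fin K) → ℝ)
    (H : Fin K → Matrix (Fin nr) (Fin nt) ℂ)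
    (Q : Fin K → Equiv.Perm (Fin K) → Matrix (Fin nt) (Fin nt) ℂ) (k : Fin K) :
    (Equiv.Perm (Fin K) → Matrix (Fin nt) (Fin nt) ℂ) →ₗ[ℝ] ℝ where
  toFun V := ∑ π, p π *
    ((sicCovariance ρ H π Q (π k))⁻¹ * ((ρ : ℂ) • (H k * V π * (H k)ᴴ))).trace.re
  map_add' V W := by
    simp only [Pi.add_apply, Matrix.mul_add, Matrix.add_mul, smul_add, Matrix.trace_add,
      Complex.add_re, mul_add, Finset.sum_add_distrib]
  map_smul' c V := by
    simp only [Pi.smul_apply, Matrix.mul_smul, Matrix.smul_mul, Matrix.trace_smul,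
      smul_comm (ρ : ℂ) c, Complex.smul_re, smul_eq_mul, Finset.mul_sum, RingHom.id_apply]
    exact Finset.sum_congr rfl fun π _ => by ring

theorem sicGradient_apply (k : Fin K) (V : Equiv.Perm (Fin K) → Matrix (Fin nt) (Fin nt) ℂ) :
    sicGradient ρ p H Q k V = ∑ π, p π *
      ((sicCovariance ρ H π Q (π k))⁻¹ * ((ρ : ℂ) • (H k * V π * (H k)ᴴ))).trace.re := rfl

theorem continuous_sicGradient (k : Fin K) : Continuous (sicGradient ρ p H Q k) := by
  simp only [funext (sicGradient_apply (ρ := ρ) (p := p) (H := H) (Q := Q) k)]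
  fun_prop

theorem continuous_sicCovariance (i : ℕ) :
    Continuous fun Q => sicCovariance ρ H π Q i := by
  unfold sicCovariance
  fun_prop

/-- The utility of a player is concave in its own strategy. -/
theorem uSICstatic_update_le (hρ : 0 < ρ) (hp : ∀ π, 0 < p π) (hQ : ∀ k π, (Q k π).PosSemidef)
    (k : Fin K) {S : Equiv.Perm (Fin K) → Matrix (Fin nt) (Fin nt) ℂ}
    (hS : ∀ π, (S π).PosSemidef) :
    uSICstatic ρ p H k (Function.update Q k S)
      ≤ uSICstatic ρ p H k Q + sicGradient ρ p H Q k (S - Q k) := by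
  have hQS : ∀ l π, (Function.update Q k S l π).PosSemidef := by
    intro l π
    rcases eq_or_ne l k with rfl | hl
    · simpa using hS π
    · simpa [hl] using hQ l π
  rw [← sub_le_iff_le_add', uSICstatic_update_sub, sicGradient_apply]
  refine Finset.sum_le_sum fun π _ => mul_le_mul_of_nonneg_left ?_ (hp π).le
  rw [Pi.sub_apply, ← sicCovariance_update, sub_le_iff_le_add']
  exact (posDef_sicCovariance hρ hQ _).logdet_le_add_trace (posDef_sicCovariance hρ hQS _)

theorem tendsto_sicGradient (hρ : 0 < ρ) (hQ : ∀ k π, (Q k π).PosSemidef) (k : Fin K)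
    {γ : ℝ → Fin K → Equiv.Perm (Fin K) → Matrix (Fin nt) (Fin nt) ℂ}
    (hγ : Continuous γ) (hγ0 : γ 0 = Q)
    (V : Equiv.Perm (Fin K) → Matrix (Fin nt) (Fin nt) ℂ) :
    Tendsto (fun t => sicGradient ρ p H (γ t) k V) (𝓝[>] 0) (𝓝 (sicGradient ρ p H Q k V)) := by
  suffices h : ContinuousAt (fun t => sicGradient ρ p H (γ t) k V) 0 by
    have := h.tendsto
    rw [hγ0] at this
    exact this.mono_left nhdsWithin_le_nhds
  simp only [sicGradient_apply]
  refine tendsto_finsetSum _ fun π _ => tendsto_const_nhds.mul ?_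
  have hdet : (sicCovariance ρ H π (γ 0) (π k)).det ≠ 0 := by
    rw [hγ0]
    exact (posDef_sicCovariance hρ hQ _).det_pos.ne'
  have hinv : ContinuousAt (fun t => (sicCovariance ρ H π (γ t) (π k))⁻¹) 0 := by
    have hc : Continuous fun t => sicCovariance ρ H π (γ t) (π k) :=
      (continuous_sicCovariance _).comp hγ
    simp only [Matrix.inv_def, Ring.inverse_eq_inv']
    exact (hc.matrix_det.continuousAt.inv₀ hdet).smul hc.matrix_adjugate.continuousAt
  have hlin : Continuous fun M : Matrix (Fin nr) (Fin nr) ℂ =>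
      (M * ((ρ : ℂ) • (H k * V π * (H k)ᴴ))).trace.re := by fun_prop
  exact hlin.continuousAt.comp hinv

/-- The pseudo-gradient of the game, with the sign that makes it monotone. -/
noncomputable def sicPseudoGradient (ρ : ℝ) (p : Equiv.Perm (Fin K) → ℝ)
    (H : Fin K → Matrix (Fin nr) (Fin nt) ℂ)
    (Q : Fin K → Equiv.Perm (Fin K) → Matrix (Fin nt) (Fin nt) ℂ) :
    (Fin K → Equiv.Perm (Fin K) → Matrix (Fin nt) (Fin nt) ℂ) →ₗ[ℝ] ℝ :=
  -∑ k, sicGradient ρ p H Q k ∘ₗ LinearMap.proj k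

theorem sicPseudoGradient_apply
    (V : Fin K → Equiv.Perm (Fin K) → Matrix (Fin nt) (Fin nt) ℂ) :
    sicPseudoGradient ρ p H Q V = -∑ k, sicGradient ρ p H Q k (V k) := by
  simp [sicPseudoGradient]

theorem eq_of_mul_mul_conjTranspose_eq {A : Matrix (Fin nr) (Fin nt) ℂ} (hA : A.rank = nt)
    {M N : Matrix (Fin nt) (Fin nt) ℂ} (h : A * M * Aᴴ = A * N * Aᴴ) : M = N := by
  have hu : IsUnit (Aᴴ * A) := by
    refine (Matrix.PosDef.conjTranspose_mul_self A ?_).isUnit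
    have := A.mulVecLin.finrank_range_add_finrank_ker
    rw [← Matrix.rank, hA, Module.finrank_fin_fun] at this
    have hk : Module.finrank ℂ (LinearMap.ker A.mulVecLin) = 0 := by omega
    exact LinearMap.ker_eq_bot.1 (Submodule.finrank_eq_zero.1 hk)
  have h' : Aᴴ * A * M * (Aᴴ * A) = Aᴴ * A * N * (Aᴴ * A) := by
    calc _ = Aᴴ * (A * M * Aᴴ) * A := by simp only [Matrix.mul_assoc]
      _ = Aᴴ * (A * N * Aᴴ) * A := by rw [h]
      _ = _ := by simp only [Matrix.mul_assoc]
  exact hu.mul_left_cancel (hu.mul_right_cancel h')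

theorem sicPseudoGradient_sub_sicPseudoGradient
    (V : Fin K → Equiv.Perm (Fin K) → Matrix (Fin nt) (Fin nt) ℂ) :
    2 * (sicPseudoGradient ρ p H R V - sicPseudoGradient ρ p H Q V)
      = ∑ π, p π * (-2 * ∑ k, (((sicCovariance ρ H π R (π k))⁻¹
        - (sicCovariance ρ H π Q (π k))⁻¹) * ((ρ : ℂ) • (H k * V k π * (H k)ᴴ))).trace.re) := by
  have e (T : Fin K → Equiv.Perm (Fin K) → Matrix (Fin nt) (Fin nt) ℂ) :
      sicPseudoGradient ρ p H T V = -∑ π, p π * ∑ k,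
        ((sicCovariance ρ H π T (π k))⁻¹ * ((ρ : ℂ) • (H k * V k π * (H k)ᴴ))).trace.re := by
    rw [sicPseudoGradient_apply]
    simp only [sicGradient_apply, Finset.mul_sum]
    rw [Finset.sum_comm]
  rw [e, e, neg_sub_neg, ← Finset.sum_sub_distrib, Finset.mul_sum]
  refine Finset.sum_congr rfl fun π _ => ?_
  rw [← mul_sub, ← Finset.sum_sub_distrib, mul_left_comm, neg_mul, ← mul_neg,
    ← Finset.sum_neg_distrib]
  congr 3
  refine funext fun k => ?_
  rw [Matrix.sub_mul, Matrix.trace_sub, Complex.sub_re, neg_sub]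

/-- The pseudo-gradient is strictly monotone, with an explicit lower bound. -/
theorem sum_invForm_le_sicPseudoGradient (hρ : 0 < ρ) (hp : ∀ π, 0 < p π)
    (hQ : ∀ k π, (Q k π).PosSemidef) (hR : ∀ k π, (R k π).PosSemidef) :
    ∑ π, p π * ∑ k, invForm (sicCovariance ρ H π R (π k)) (sicCovariance ρ H π Q (π k))
        ((ρ : ℂ) • (H k * (R k π - Q k π) * (H k)ᴴ))
      ≤ 2 * (sicPseudoGradient ρ p H R (R - Q) - sicPseudoGradient ρ p H Q (R - Q)) := by
  rw [sicPseudoGradient_sub_sicPseudoGradient]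
  refine Finset.sum_le_sum fun π _ => mul_le_mul_of_nonneg_left ?_ (hp π).le
  have hK : sicCovariance ρ H π R K = sicCovariance ρ H π Q K := by
    rw [sicCovariance, sicCovariance, Finset.filter_false_of_mem fun ℓ _ => by omega,
      Finset.sum_empty, Finset.sum_empty]
  have hd (k : Fin K) : sicCovariance ρ H π R (π k) - sicCovariance ρ H π R (π k + 1)
      - (sicCovariance ρ H π Q (π k) - sicCovariance ρ H π Q (π k + 1))
      = (ρ : ℂ) • (H k * (R - Q) k π * (H k)ᴴ) := by
    rw [sicCovariance_sub_succ, sicCovariance_sub_succ, ← smul_sub, ← Matrix.sub_mul,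
      ← Matrix.mul_sub, Pi.sub_apply, Pi.sub_apply]
  have h := sum_invForm_le_sum_trace (posDef_sicCovariance (H := H) (π := π) hρ hR)
    (posDef_sicCovariance (H := H) (π := π) hρ hQ)
    (posSemidef_sicCovariance_sub_succ hρ hR) (posSemidef_sicCovariance_sub_succ hρ hQ) hK
  have hs (f : ℕ → ℝ) : ∑ i ∈ Finset.range K, f i = ∑ k, f (π k) := by
    rw [Finset.sum_range, ← Equiv.sum_comp π]
  rw [hs, hs] at h
  simp only [hd] at h
  exact h

theorem isHermitian_smul_mul_sub_mul (hQ : ∀ k π, (Q k π).PosSemidef)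
    (hR : ∀ k π, (R k π).PosSemidef) (k : Fin K) :
    ((ρ : ℂ) • (H k * (R k π - Q k π) * (H k)ᴴ)).IsHermitian := by
  have := Matrix.isHermitian_mul_mul_conjTranspose (H k) ((hR k π).1.sub (hQ k π).1)
  rw [Matrix.IsHermitian, Matrix.conjTranspose_smul, this.eq, Complex.star_def,
    Complex.conj_ofReal]

theorem sicPseudoGradient_monotone (hρ : 0 < ρ) (hp : ∀ π, 0 < p π)
    (hQ : ∀ k π, (Q k π).PosSemidef) (hR : ∀ k π, (R k π).PosSemidef) :
    0 ≤ sicPseudoGradient ρ p H R (R - Q) - sicPseudoGradient ρ p H Q (R - Q) := by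
  have h := sum_invForm_le_sicPseudoGradient (H := H) hρ hp hQ hR
  have h0 := Finset.sum_nonneg fun π (_ : π ∈ Finset.univ) => mul_nonneg (hp π).le
    (Finset.sum_nonneg fun k (_ : k ∈ Finset.univ) => invForm_nonneg
      (posDef_sicCovariance (H := H) (π := π) hρ hR (π k))
      (posDef_sicCovariance (H := H) (π := π) hρ hQ (π k))
      (isHermitian_smul_mul_sub_mul (ρ := ρ) (H := H) (π := π) hQ hR k))
  linarith

theorem eq_of_sicPseudoGradient_le (hρ : 0 < ρ) (hp : ∀ π, 0 < p π)
    (hrank : ∀ k, (H k).rank = nt)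
    (hQ : ∀ k π, (Q k π).PosSemidef) (hR : ∀ k π, (R k π).PosSemidef)
    (hle : sicPseudoGradient ρ p H R (R - Q) - sicPseudoGradient ρ p H Q (R - Q) ≤ 0) :
    R = Q := by
  have h := sum_invForm_le_sicPseudoGradient (H := H) hρ hp hQ hR
  have hX (π) (k : Fin K) := posDef_sicCovariance (H := H) (π := π) hρ hR (π k)
  have hY (π) (k : Fin K) := posDef_sicCovariance (H := H) (π := π) hρ hQ (π k)
  have hD (π) := isHermitian_smul_mul_sub_mul (ρ := ρ) (H := H) (π := π) hQ hR
  have h1 (π) := Finset.sum_nonneg fun k (_ : k ∈ Finset.univ) =>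
    invForm_nonneg (hX π k) (hY π k) (hD π k)
  have h2 (π) := mul_nonneg (hp π).le (h1 π)
  have h3 := (Finset.sum_eq_zero_iff_of_nonneg fun π _ => h2 π).1
    (le_antisymm (by linarith) (Finset.sum_nonneg fun π _ => h2 π))
  funext k π
  have h4 := (mul_eq_zero.1 (h3 π (Finset.mem_univ π))).resolve_left (hp π).ne'
  have h5 := (Finset.sum_eq_zero_iff_of_nonneg fun k _ =>
    invForm_nonneg (hX π k) (hY π k) (hD π k)).1 h4 k (Finset.mem_univ k)
  have h6 := (hY π k).inv.eq_zero_of_re_trace_form (hX π k).inv (hD π k) h5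
  rw [smul_eq_zero_iff_right (Complex.ofReal_ne_zero.2 hρ.ne'), Matrix.mul_sub, Matrix.sub_mul,
    sub_eq_zero] at h6
  exact eq_of_mul_mul_conjTranspose_eq (hrank k) h6

/-- Nash equilibria are the solutions of the variational inequality of the pseudo-gradient. -/
theorem nash_iff_sicPseudoGradient_nonneg (hρ : 0 < ρ) (hp : ∀ π, 0 < p π) {Pbar : Fin K → ℝ}
    (hQ : ∀ k, Q k ∈ SICset K nt p (Pbar k)) :
    (∀ k, ∀ S ∈ SICset K nt p (Pbar k),
        uSICstatic ρ p H k (Function.update Q k S) ≤ uSICstatic ρ p H k Q) ↔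
      ∀ R ∈ Set.univ.pi fun k => SICset K nt p (Pbar k),
        0 ≤ sicPseudoGradient ρ p H Q (R - Q) := by
  have hQ' : ∀ k π, (Q k π).PosSemidef := fun k => (hQ k).1
  constructor
  · intro hN R hR
    rw [sicPseudoGradient_apply, neg_nonneg]
    refine Finset.sum_nonpos fun k _ => ?_
    have hc : Continuous fun t : ℝ => Function.update Q k (Q k + t • (R k - Q k)) :=
      continuous_const.update k (by fun_prop)
    refine le_of_tendsto (tendsto_sicGradient hρ hQ' k hc (by simp) _) ?_
    filter_upwards [Ioc_mem_nhdsGT (zero_lt_one' ℝ)] with t ht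
    have hS := (convex_SICset (Pbar k)).add_smul_sub_mem (hQ k) (hR k (Set.mem_univ k))
      ⟨ht.1.le, ht.2⟩
    have hU : ∀ l π, (Function.update Q k (Q k + t • (R k - Q k)) l π).PosSemidef := by
      intro l π
      rcases eq_or_ne l k with rfl | hl
      · simpa using hS.1 π
      · simpa [hl] using hQ' l π
    have h := uSICstatic_update_le (H := H) hρ hp hU k (hQ' k)
    rw [Function.update_idem, Function.update_eq_self, Function.update_self, sub_add_cancel_left,
      map_neg, map_smul, smul_eq_mul] at h
    have h' := hN k _ hS
    rw [Pi.sub_apply]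
    exact nonpos_of_mul_nonpos_right (by linarith) ht.1
  · intro hV k S hS
    have h := hV (Function.update Q k S) fun l _ => by
      rcases eq_or_ne l k with rfl | hl
      · simpa using hS
      · simpa [hl] using hQ l
    rw [sicPseudoGradient_apply, Finset.sum_eq_single k (fun l _ hl => by simp [hl]) (by simp),
      Pi.sub_apply, Function.update_self] at h
    linarith [uSICstatic_update_le (H := H) hρ hp hQ' k hS.1]

end Game

/-- with fixed full-column-rank channel matrices and strictly positive
weights on the decoding orders, the static SIC space-time power allocation game has
exactly one Nash equilibrium. -/
theorem existsUnique_nash_equilibrium_SIC_static {K nt nr : ℕ} (hK : 1 ≤ K)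
    (hnt : 1 ≤ nt) (hnr : 1 ≤ nr) (ρ : ℝ) (hρ : 0 < ρ)
    (Pbar : Fin K → ℝ) (hPbar : ∀ k, 0 < Pbar k)
    (p : Equiv.Perm (Fin K) → ℝ) (hp : ∀ π, 0 < p π) (hp1 : ∑ π, p π = 1)
    (H : Fin K → Matrix (Fin nr) (Fin nt) ℂ)
    (hrank : ∀ k, (H k).rank = nt) :
    ∃! Q : Fin K → Equiv.Perm (Fin K) → Matrix (Fin nt) (Fin nt) ℂ,
      (∀ k, Q k ∈ SICset K nt p (Pbar k)) ∧
      ∀ k, ∀ R ∈ SICset K nt p (Pbar k),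
        uSICstatic ρ p H k (Function.update Q k R) ≤ uSICstatic ρ p H k Q := by
  have hpsd {Q : Fin K → Equiv.Perm (Fin K) → Matrix (Fin nt) (Fin nt) ℂ}
      (hQ : Q ∈ Set.univ.pi fun k => SICset K nt p (Pbar k)) (k : Fin K) :
      ∀ π, (Q k π).PosSemidef := (hQ k (Set.mem_univ k)).1
  obtain ⟨Q, hQ, hQV⟩ := exists_variational_solution
    (convex_pi fun k _ => convex_SICset (Pbar k))
    (isCompact_univ_pi fun k => isCompact_SICset hp (Pbar k))
    ⟨0, fun k _ => ⟨fun _ => .zero, by simpa using mul_nonneg nt.cast_nonneg (hPbar k).le⟩⟩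
    (sicPseudoGradient ρ p H)
    (fun Q => by
      simp only [funext (sicPseudoGradient_apply (ρ := ρ) (p := p) (H := H) (Q := Q))]
      exact (continuous_finsetSum _ fun k _ =>
        (continuous_sicGradient k).comp (continuous_apply k)).neg)
    (fun Q hQ R hR => sicPseudoGradient_monotone hρ hp (hpsd hQ) (hpsd hR))
    (fun Q hQ R _ => by
      simp only [sicPseudoGradient_apply]
      exact (tendsto_finsetSum _ fun k _ =>
        tendsto_sicGradient hρ (hpsd hQ) k (by fun_prop) (by simp) _).neg)
  have hQ' : ∀ k, Q k ∈ SICset K nt p (Pbar k) := fun k => hQ k (Set.mem_univ k)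
  refine ⟨Q, ⟨hQ', (nash_iff_sicPseudoGradient_nonneg hρ hp hQ').2 hQV⟩, ?_⟩
  rintro R ⟨hR', hRN⟩
  have hR : R ∈ Set.univ.pi fun k => SICset K nt p (Pbar k) := fun k _ => hR' k
  have h1 := (nash_iff_sicPseudoGradient_nonneg hρ hp hR').1 hRN Q hQ
  have h2 := hQV R hR
  refine eq_of_sicPseudoGradient_le hρ hp hrank (hpsd hQ) (hpsd hR) ?_
  rw [← neg_sub R Q, map_neg] at h1
  linarith
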